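/- The diagrams δ^(k) form a nested (staircase) chain: for every k with 1 ≤ k < d − r + 1 one has δ^(k)_i ≤ δ^(k+1)_i for all 1 ≤ i ≤ r. -/

import Mathlib

/-- The length of the `k`-th column of the Young diagram `δ` (indexed from 1):
`col δ k = #{i ≥ 1 : δ_i ≥ k}`. -/
noncomputable def col (δ : ℕ → ℕ) (k : ℕ) : ℕ := Nat.card {i : ℕ | 1 ≤ i ∧ k ≤ δ i}

/-- The Young diagram `δ^(k)` of the twisted Lascoux complex (Donovan–Segal, Thm A.7):
with `c := col δ k`, we have `δ^(k)_i = δ_i` for `1 ≤ i ≤ c`, `δ^(k)_{c+1} = k`, and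
`δ^(k)_i = δ_{i-1} + 1` for `i ≥ c + 2`. -/
noncomputable def deltaK (δ : ℕ → ℕ) (k : ℕ) (i : ℕ) : ℕ :=
  if i ≤ col δ k then δ i
  else if i = col δ k + 1 then k
  else δ (i - 1) + 1

/-- The homological data `s_k := r + k - (col_k(δ) + 1)` of the twisted Lascoux complex. -/
noncomputable def sK (δ : ℕ → ℕ) (r k : ℕ) : ℕ := r + k - (col δ k + 1)

/-- The size `|δ| := Σ_{i ≥ 1} δ_i` of the Young diagram `δ`. -/
noncomputable def ysize (δ : ℕ → ℕ) : ℕ := ∑ᶠ i : ℕ, δ (i + 1)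

/-- Columns of a Young diagram are initial segments: `(i, k)` is a box of `δ` if and only if `i`
is at most the length of the `k`-th column. -/
theorem le_col_iff {δ : ℕ → ℕ} (hmono : ∀ i, 1 ≤ i → δ (i + 1) ≤ δ i)
    (hfin : ∃ N, ∀ i, N ≤ i → δ i = 0) {i k : ℕ} (hi : 1 ≤ i) (hk : 1 ≤ k) :
    i ≤ col δ k ↔ k ≤ δ i := by
  have hanti : ∀ a b, 1 ≤ a → a ≤ b → δ b ≤ δ a := by
    intro a b ha hab
    induction b, hab using Nat.le_induction with
    | base => exact le_rfl
    | succ n hn ih => exact (hmono n (ha.trans hn)).trans ih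
  have hex : ∃ m, δ (m + 1) < k := by
    obtain ⟨N, hN⟩ := hfin
    exact ⟨N, by rw [hN (N + 1) N.le_succ]; exact hk⟩
  classical
  have hbox : ∀ j, 1 ≤ j → (k ≤ δ j ↔ j ≤ Nat.find hex) := by
    intro j hj
    constructor
    · intro h
      by_contra! hlt
      exact absurd (h.trans (hanti _ _ (Nat.succ_pos _) hlt)) (Nat.find_spec hex).not_ge
    · intro h
      have := Nat.find_min hex (m := j - 1) (by omega)
      rwa [Nat.sub_add_cancel hj, not_lt] at this
  have hset : {i : ℕ | 1 ≤ i ∧ k ≤ δ i} = ↑(Finset.Icc 1 (Nat.find hex)) := by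
    ext j
    simp only [Set.mem_ofPred_eq, Finset.coe_Icc, Set.mem_Icc]
    exact and_congr_right (hbox j)
  have hcol : col δ k = Nat.find hex := by
    rw [col, hset, Nat.card_coe_set_eq, Set.ncard_coe_finset, Nat.card_Icc, Nat.add_sub_cancel]
  rw [hcol, hbox i hi]

/-- the diagrams `δ^(k)` form a nested (staircase) chain: for every
`1 ≤ k < d - r + 1` one has `δ^(k)_i ≤ δ^(k+1)_i` for all `1 ≤ i ≤ r`. -/
theorem deltaK_nested
    (d r : ℕ) (hr : 1 ≤ r) (hrd : r ≤ d)
    (δ : ℕ → ℕ)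
    (hmono : ∀ i, 1 ≤ i → δ (i + 1) ≤ δ i)
    (hfin : ∃ N, ∀ i, N ≤ i → δ i = 0)
    (hrow : δ 1 ≤ d - r + 1)
    (hcol : col δ 1 ≤ r - 1) :
    ∀ k, 1 ≤ k → k < d - r + 1 →
      ∀ i, 1 ≤ i → i ≤ r → deltaK δ k i ≤ deltaK δ (k + 1) i := by
  intro k hk _ i hi _
  have box := fun {j l : ℕ} (hj : 1 ≤ j) (hl : 1 ≤ l) => le_col_iff hmono hfin hj hl
  have hk' : 1 ≤ k + 1 := Nat.succ_pos k
  have hle : col δ (k + 1) ≤ col δ k := by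
    rcases Nat.eq_zero_or_pos (col δ (k + 1)) with h | h
    · omega
    · exact (box h hk).2 ((Nat.le_succ k).trans ((box h hk').1 le_rfl))
  have hi_box := box hi hk'
  have hprev : 2 ≤ i → δ i ≤ δ (i - 1) ∧ (i - 1 ≤ col δ k ↔ k ≤ δ (i - 1)) := by
    intro h
    have h1 : 1 ≤ i - 1 := by omega
    have hstep := hmono (i - 1) h1
    rw [Nat.sub_add_cancel hi] at hstep
    exact ⟨hstep, box h1 hk⟩
  unfold deltaK
  split_ifs <;> omega
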